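/- arXiv:1804.10895 — 10 statements merged into one kernel-verified Lean document; each statement's English description precedes it below -/
import Mathlib

section
/- Let H be an additive commutative monoid, let Φ be a vector space over ℚ (an abelian group with division by integers), and let n ≥ 1. Suppose f : H^n → Φ is symmetric (f(x_{π(1)},…,x_{π(n)}) = f(x_1,…,x_n) for every permutation π of {1,…,n}) and additive in each argument (for each index i and fixed other arguments, x ↦ f(…,x,…) is additive). Define F : H → Φ by F(y) = f(y,…,y). Then for every γ ∈ H and every (x_1,…,x_n) ∈ H^n one has n! • f(x_1,…,x_n) = Σ_{S ⊆ {1,…,n}} (−1)^{n−|S|} F(γ + Σ_{j∈S} x_j), where the sum ranges over all subsets S of {1,…,n} including the empty set. -/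
open Finset in
/-- The signed count of the finsets containing a given finset `T` vanishes unless `T` is
everything. -/
theorem Finset.sum_superset_neg_one_pow_card_compl {ι : Type*} [Fintype ι] [DecidableEq ι]
    (T : Finset ι) :
    ∑ S : Finset ι with T ⊆ S, (-1 : ℤ) ^ (Fintype.card ι - #S) =
      if T = univ then 1 else 0 := by
  have h : ∑ S : Finset ι with T ⊆ S, (-1 : ℤ) ^ (Fintype.card ι - #S) =
      ∑ S ∈ Tᶜ.powerset, (-1 : ℤ) ^ #S := by
    refine sum_nbij' (fun S => Sᶜ) (fun S => Sᶜ) ?_ ?_ ?_ ?_ ?_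
    · intro S hS
      simpa using hS
    · intro S hS
      simpa [subset_compl_comm] using hS
    · simp
    · simp
    · simp [card_compl]
  rw [h, sum_powerset_neg_one_pow_card]
  simp

/-- A map `ι → Option ι` hitting every `some j` is `some ∘ π` for a permutation `π`. -/
theorem exists_perm_of_forall_exists_eq_some {ι : Type*} [Finite ι] {r : ι → Option ι}
    (hr : ∀ j, ∃ i, r i = some j) : ∃ π : Equiv.Perm ι, (fun i => some (π i)) = r := by
  choose g hg using hr
  have hinj : Function.Injective g := fun a b hab =>
    Option.some_injective _ (by rw [← hg a, ← hg b, hab])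
  let e := Equiv.ofBijective g (Finite.injective_iff_bijective.mp hinj)
  refine ⟨e.symm, funext fun i => ?_⟩
  rw [← hg]
  exact congrArg r (e.apply_symm_apply i)

open Finset in
/-- Polarization of a multilinear map, without assuming symmetry. -/
theorem MultilinearMap.sum_perm_eq_sum_neg_one_pow_smul {R ι M N : Type*} [Semiring R]
    [AddCommMonoid M] [Module R M] [AddCommGroup N] [Module R N] [Fintype ι] [DecidableEq ι]
    (f : MultilinearMap R (fun _ : ι => M) N) (γ : M) (x : ι → M) :
    ∑ π : Equiv.Perm ι, f (x ∘ π) =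
      ∑ S : Finset ι, ((-1 : ℤ) ^ (Fintype.card ι - #S)) • f (fun _ => γ + ∑ j ∈ S, x j) := by
  let z : Option ι → M := fun o => o.elim γ x
  let T : (ι → Option ι) → Finset ι := fun r => {j | ∃ i, r i = some j}
  have hexpand (S : Finset ι) : f (fun _ => γ + ∑ j ∈ S, x j) =
      ∑ r : ι → Option ι with T r ⊆ S, f (z ∘ r) := by
    have hz : γ + ∑ j ∈ S, x j = ∑ o ∈ insertNone S, z o := by simp [z]
    simp_rw [hz]
    rw [f.map_sum_finset (fun _ => z) (fun _ => insertNone S)]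
    refine sum_congr ?_ fun _ _ => rfl
    ext r
    simp only [Fintype.mem_piFinset, mem_insertNone, Option.mem_def, mem_filter, mem_univ,
      true_and, subset_iff, T]
    exact ⟨fun h j ⟨i, hi⟩ => h i j hi, fun h i j hi => h ⟨i, hi⟩⟩
  have hswap : ∑ S : Finset ι,
        ((-1 : ℤ) ^ (Fintype.card ι - #S)) • f (fun _ => γ + ∑ j ∈ S, x j) =
      ∑ r : ι → Option ι with T r = univ, f (z ∘ r) := by
    simp_rw [hexpand, smul_sum]
    rw [sum_comm' (t' := univ) (s' := fun r => {S | T r ⊆ S}) (by simp)]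
    simp_rw [← sum_smul, sum_superset_neg_one_pow_card_compl, ite_smul, one_smul, zero_smul]
    rw [sum_filter]
  rw [hswap]
  refine sum_bij (fun π _ i => some (π i)) ?_ ?_ ?_ ?_
  · intro π _
    simp only [mem_filter, mem_univ, true_and, T, eq_univ_iff_forall]
    exact fun j => ⟨π.symm j, by simp⟩
  · intro π _ σ _ h
    exact Equiv.ext fun i => Option.some_injective _ (congrFun h i)
  · intro r hr
    simp only [mem_filter, mem_univ, true_and, T, eq_univ_iff_forall] at hr
    obtain ⟨π, hπ⟩ := exists_perm_of_forall_exists_eq_some hr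
    exact ⟨π, mem_univ _, hπ⟩
  · intro π _
    rfl

/-- A function additive in each argument is `ℕ`-multilinear. -/
def MultilinearMap.ofMapUpdateAdd {ι M N : Type*} [d : DecidableEq ι] [AddCommMonoid M]
    [AddCommGroup N] (f : (ι → M) → N)
    (hadd : ∀ (i : ι) (x : ι → M) (a b : M),
      f (Function.update x i (a + b)) =
        f (Function.update x i a) + f (Function.update x i b)) :
    MultilinearMap ℕ (fun _ : ι => M) N where
  toFun := f
  map_update_add' {inst} x i a b := by
    obtain rfl := Subsingleton.elim inst d
    exact hadd i x a b
  map_update_smul' {inst} x i c a := by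
    obtain rfl := Subsingleton.elim inst d
    exact map_nsmul (AddMonoidHom.mk' (fun y => f (Function.update x i y)) (hadd i x)) c a

/-- **Polarization theorem, forward direction.**  If `f : H^n → Φ` is symmetric and
additive in each argument, then for every `γ` and every `x`,
`n! • f x = ∑_{S ⊆ {1,…,n}} (−1)^{n−|S|} F(γ + ∑_{j∈S} x j)` where `F(y) = f(y,…,y)`. -/
theorem polarization_forward
    {H : Type*} [AddCommMonoid H]
    {Φ : Type*} [AddCommGroup Φ] [Module ℚ Φ]
    (n : ℕ) (hn : 1 ≤ n)
    (f : (Fin n → H) → Φ)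
    (hsymm : ∀ (π : Equiv.Perm (Fin n)) (x : Fin n → H), f (x ∘ π) = f x)
    (hadd : ∀ (i : Fin n) (x : Fin n → H) (a b : H),
      f (Function.update x i (a + b)) =
        f (Function.update x i a) + f (Function.update x i b))
    (F : H → Φ) (hF : ∀ y : H, F y = f (fun _ => y))
    (γ : H) (x : Fin n → H) :
    n.factorial • f x =
      ∑ S : Finset (Fin n),
        ((-1 : ℤ) ^ (n - S.card)) • F (γ + ∑ j ∈ S, x j) := by
  have h := (MultilinearMap.ofMapUpdateAdd f hadd).sum_perm_eq_sum_neg_one_pow_smul γ x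
  change ∑ π : Equiv.Perm (Fin n), f (x ∘ π) = ∑ S : Finset (Fin n),
    ((-1 : ℤ) ^ (Fintype.card (Fin n) - S.card)) • f (fun _ => γ + ∑ j ∈ S, x j) at h
  simpa [hsymm, ← hF, Fintype.card_perm] using h
end

section
/- Let H be an additive commutative monoid, let Φ be a vector space over ℚ, and let n ≥ 1. Suppose f : H^n → Φ is a function such that, with F : H → Φ defined by F(y) = f(y,…,y), the identity n! • f(x_1,…,x_n) = Σ_{S ⊆ {1,…,n}} (−1)^{n−|S|} F(γ + Σ_{j∈S} x_j) holds for every γ ∈ H and every (x_1,…,x_n) ∈ H^n. Then f is symmetric (invariant under every permutation of its n arguments) and additive in each argument. -/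
/-- Splitting the alternating subset sum according to whether `S` contains `i`: the subset sum is
a difference in the direction of the `i`-th argument. -/
theorem alternating_subset_sum_update {H Φ : Type*} [AddCommMonoid H] [AddCommGroup Φ]
    {n : ℕ} (F : H → Φ) (i : Fin n) (x : Fin n → H) (γ c : H) :
    ∑ S : Finset (Fin n),
        ((-1 : ℤ) ^ (n - S.card)) • F (γ + ∑ j ∈ S, Function.update x i c j) =
      ∑ S ∈ (Finset.univ.erase i).powerset,
          ((-1 : ℤ) ^ (n - S.card)) • F (γ + ∑ j ∈ S, x j) -
        ∑ S ∈ (Finset.univ.erase i).powerset,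
          ((-1 : ℤ) ^ (n - S.card)) • F (γ + c + ∑ j ∈ S, x j) := by
  have hi : i ∉ Finset.univ.erase i := Finset.notMem_erase i _
  rw [← Finset.powerset_univ, ← Finset.insert_erase (Finset.mem_univ i),
    Finset.sum_powerset_insert hi, Finset.insert_erase (Finset.mem_univ i), sub_eq_add_neg,
    ← Finset.sum_neg_distrib]
  have hnot : ∀ S ∈ (Finset.univ.erase i).powerset, i ∉ S :=
    fun S hS h => hi (Finset.mem_powerset.mp hS h)
  congr 1
  · refine Finset.sum_congr rfl fun S hS => ?_
    rw [Finset.sum_update_of_notMem (hnot S hS)]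
  · refine Finset.sum_congr rfl fun S hS => ?_
    have hcard : (insert i S).card = S.card + 1 := Finset.card_insert_of_notMem (hnot S hS)
    have hle : S.card + 1 ≤ n := by
      simpa [hcard] using Finset.card_le_univ (insert i S)
    have hexp : n - S.card = n - (S.card + 1) + 1 := by omega
    rw [Finset.sum_insert (hnot S hS), Finset.sum_update_of_notMem (hnot S hS),
      Function.update_self, hcard, hexp, pow_succ, mul_neg_one, neg_smul, neg_neg, add_assoc]

/-- **Polarization theorem, converse direction.**  If `f : H^n → Φ` satisfies the
polarization identity
`n! • f x = ∑_{S ⊆ {1,…,n}} (−1)^{n−|S|} F(γ + ∑_{j∈S} x j)` (where `F(y) = f(y,…,y)`)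
for every `γ` and every `x`, then `f` is symmetric and additive in each argument. -/
theorem polarization_converse
    {H : Type*} [AddCommMonoid H]
    {Φ : Type*} [AddCommGroup Φ] [Module ℚ Φ]
    (n : ℕ) (hn : 1 ≤ n)
    (f : (Fin n → H) → Φ)
    (F : H → Φ) (hF : ∀ y : H, F y = f (fun _ => y))
    (hpol : ∀ (γ : H) (x : Fin n → H),
      n.factorial • f x =
        ∑ S : Finset (Fin n),
          ((-1 : ℤ) ^ (n - S.card)) • F (γ + ∑ j ∈ S, x j)) :
    (∀ (π : Equiv.Perm (Fin n)) (x : Fin n → H), f (x ∘ π) = f x) ∧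
    (∀ (i : Fin n) (x : Fin n → H) (a b : H),
      f (Function.update x i (a + b)) =
        f (Function.update x i a) + f (Function.update x i b)) := by
  have cancel : ∀ u v : Φ, n.factorial • u = n.factorial • v → u = v := by
    intro u v h
    rw [← Nat.cast_smul_eq_nsmul ℚ, ← Nat.cast_smul_eq_nsmul ℚ] at h
    exact smul_right_injective Φ (Nat.cast_ne_zero.mpr n.factorial_ne_zero) h
  refine ⟨fun π x => cancel _ _ ?_, fun i x a b => cancel _ _ ?_⟩
  · rw [hpol 0, hpol 0]
    refine Fintype.sum_equiv (Equiv.finsetCongr π) _ _ fun S => ?_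
    simp [Equiv.finsetCongr_apply]
  · rw [smul_add, hpol 0 (Function.update x i (a + b)), hpol 0 (Function.update x i a),
      hpol a (Function.update x i b)]
    simp only [alternating_subset_sum_update]
    rw [zero_add a, zero_add (a + b), sub_add_sub_cancel]
end

section
/- Let K be a commutative ring that is a ℚ-algebra, let n ≥ 1, let A = (a_{ij}) be an n×n matrix over K, and let γ ∈ K be arbitrary. Then n! • det(A) = [ Σ_{σ even} (γ + Σ_{i=1}^n a_{iσ(i)})^n − Σ_{σ odd} (γ + Σ_{i=1}^n a_{iσ(i)})^n ] − [ Σ_{σ even} Σ_{s=1}^n (γ + Σ_{i≠s} a_{iσ(i)})^n − Σ_{σ odd} Σ_{s=1}^n (γ + Σ_{i≠s} a_{iσ(i)})^n ], where σ ranges over even, respectively odd, permutations of {1,…,n}. Equivalently, det(A) = (1/n!) Σ_{σ ∈ S_n} sgn(σ) [ (γ + Σ_{i=1}^n a_{iσ(i)})^n − Σ_{s=1}^n (γ + Σ_{i≠s} a_{iσ(i)})^n ]. -/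
open Finset

/-- Polarization: the alternating sum of `(γ + ∑ i ∈ S, x i) ^ m` over the subsets `S` of `T`
vanishes for `m < #T` and is `(#T)! * ∏ i ∈ T, x i` for `m = #T`. -/
theorem sum_powerset_neg_one_pow_mul_add_sum_pow {ι R : Type*} [DecidableEq ι] [CommRing R]
    (x : ι → R) (T : Finset ι) (m : ℕ) (hm : m ≤ #T) (γ : R) :
    ∑ S ∈ T.powerset, (-1) ^ (#T + #S) * (γ + ∑ i ∈ S, x i) ^ m =
      if m = #T then ((#T).factorial : R) * ∏ i ∈ T, x i else 0 := by
  induction T using Finset.induction_on generalizing m γ with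
  | empty => simp_all
  | insert a T ha ih =>
    rw [card_insert_of_notMem ha] at hm ⊢
    have key : ∑ S ∈ (insert a T).powerset, (-1) ^ (#T + 1 + #S) * (γ + ∑ i ∈ S, x i) ^ m =
        ∑ k ∈ range m, x a ^ (m - k) * (m.choose k : R) *
          ∑ S ∈ T.powerset, (-1) ^ (#T + #S) * (γ + ∑ i ∈ S, x i) ^ k := by
      simp_rw [mul_sum]
      rw [sum_comm, sum_powerset_insert ha, ← sum_add_distrib]
      refine sum_congr rfl fun S hS => ?_
      have haS : a ∉ S := fun h => ha (mem_powerset.1 hS h)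
      have hpow := add_pow (γ + ∑ i ∈ S, x i) (x a) m
      rw [sum_range_succ] at hpow
      have hsum : ∑ k ∈ range m, x a ^ (m - k) * (m.choose k : R) *
          ((-1) ^ (#T + #S) * (γ + ∑ i ∈ S, x i) ^ k) = (-1) ^ (#T + #S) *
          ∑ k ∈ range m, (γ + ∑ i ∈ S, x i) ^ k * x a ^ (m - k) * (m.choose k : R) := by
        rw [mul_sum]
        exact sum_congr rfl fun k _ => by ring
      rw [hsum, eq_sub_of_add_eq hpow.symm, card_insert_of_notMem haS, sum_insert haS]
      simp only [Nat.sub_self, Nat.choose_self, Nat.cast_one]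
      ring
    rw [key, sum_congr rfl fun k hk => by
      rw [ih k (by have := mem_range.1 hk; omega) γ]]
    split_ifs with h
    · subst h
      rw [sum_range_succ, sum_eq_zero fun k hk => by rw [if_neg (mem_range.1 hk).ne, mul_zero]]
      simp [prod_insert ha, Nat.factorial_succ]
      ring
    · refine sum_eq_zero fun k hk => ?_
      rw [if_neg (by have := mem_range.1 hk; omega), mul_zero]

/-- A signed sum over permutations vanishes when the summand depends only on the values of the
permutation on a set missing two distinct points. -/
theorem sum_sign_smul_eq_zero_of_notMem {ι M : Type*} [DecidableEq ι] [Fintype ι]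
    [AddCommGroup M] (S : Finset ι) {i j : ι} (hij : i ≠ j) (hi : i ∉ S) (hj : j ∉ S)
    (F : Equiv.Perm ι → M) (hF : ∀ σ τ : Equiv.Perm ι, (∀ k ∈ S, σ k = τ k) → F σ = F τ) :
    ∑ σ : Equiv.Perm ι, (Equiv.Perm.sign σ : ℤ) • F σ = 0 := by
  refine sum_involution (fun σ _ => σ * Equiv.swap i j) (fun σ _ => ?_) (fun σ _ _ h => ?_)
    (fun _ _ => mem_univ _) (fun σ _ => by simp [mul_assoc])
  · rw [hF (σ * Equiv.swap i j) σ fun k hk => ?_]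
    · simp [Equiv.Perm.sign_swap hij]
    · rw [Equiv.Perm.mul_apply, Equiv.swap_apply_of_ne_of_ne]
      · exact fun h => hi (h ▸ hk)
      · exact fun h => hj (h ▸ hk)
  · exact hij (Equiv.swap_eq_one_iff.1 (mul_eq_left.1 h))

/-- A sum over all subsets supported on those of codimension at most one. -/
theorem sum_univ_finset_eq_add_sum_erase {ι M : Type*} [DecidableEq ι] [Fintype ι]
    [AddCommMonoid M] (f : Finset ι → M)
    (hf : ∀ S : Finset ι, ∀ i j, i ≠ j → i ∉ S → j ∉ S → f S = 0) :
    ∑ S, f S = f univ + ∑ s, f (univ.erase s) := by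
  have hinj : Function.Injective fun s : ι => univ.erase s := fun s t h => by
    by_contra hne
    have : s ∈ univ.erase s := by
      simp only at h
      rw [h]
      simp [hne]
    simp at this
  have hnot : (univ : Finset ι) ∉ univ.image fun s : ι => univ.erase s := by simp
  rw [← sum_image (f := f) (g := fun s : ι => univ.erase s) fun _ _ _ _ h => hinj h,
    ← sum_insert hnot]
  refine (sum_subset (subset_univ _) fun S _ hS => ?_).symm
  simp only [mem_insert, mem_image, mem_univ, true_and, not_or, not_exists] at hS
  obtain ⟨i, hi⟩ : ∃ i, i ∉ S := by
    by_contra! h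
    exact hS.1 (eq_univ_iff_forall.2 h)
  obtain ⟨j, hji, hj⟩ : ∃ j, j ≠ i ∧ j ∉ S := by
    by_contra! h
    refine hS.2 i (ext fun k => ?_)
    by_cases hk : k = i
    · simp [hk, hi]
    · simp [hk, h k hk]
  exact hf S i j hji.symm hi hj


/-- **Polynomial identity for determinants (Egorychev, 2012), general `γ`.**
`n! • det A = ∑_{σ} sgn σ • [(γ + ∑_i a_{iσ(i)})^n − ∑_s (γ + ∑_{i≠s} a_{iσ(i)})^n]`. -/
theorem det_polynomial_identity
    {K : Type*} [CommRing K] [Algebra ℚ K]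
    (n : ℕ) (hn : 1 ≤ n)
    (A : Matrix (Fin n) (Fin n) K) (γ : K) :
    n.factorial • A.det =
      ∑ σ : Equiv.Perm (Fin n), (Equiv.Perm.sign σ : ℤ) •
        ((γ + ∑ i, A i (σ i)) ^ n -
          ∑ s : Fin n, (γ + ∑ i ∈ Finset.univ.erase s, A i (σ i)) ^ n) := by
  have hprod (σ : Equiv.Perm (Fin n)) : (n.factorial : K) * ∏ i, A i (σ i) =
      ∑ S : Finset (Fin n), (-1) ^ (n + #S) * (γ + ∑ i ∈ S, A i (σ i)) ^ n := by
    have h := sum_powerset_neg_one_pow_mul_add_sum_pow (fun i => A i (σ i)) univ n (by simp) γ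
    simpa using h.symm
  have hsupp (σ : Equiv.Perm (Fin n)) : (γ + ∑ i, A i (σ i)) ^ n -
      ∑ s : Fin n, (γ + ∑ i ∈ univ.erase s, A i (σ i)) ^ n =
      (-1) ^ (n + #(univ : Finset (Fin n))) * (γ + ∑ i, A i (σ i)) ^ n +
      ∑ s : Fin n, (-1) ^ (n + #(univ.erase s)) * (γ + ∑ i ∈ univ.erase s, A i (σ i)) ^ n := by
    have hodd : Odd (n + (n - 1)) := ⟨n - 1, by omega⟩
    simp [hodd.neg_one_pow, sub_eq_add_neg]
  simp_rw [hsupp]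
  rw [← A.det_transpose, Matrix.det_apply, smul_sum]
  simp_rw [smul_add, sum_add_distrib, smul_sum]
  rw [sum_comm (s := (univ : Finset (Equiv.Perm (Fin n)))), ← sum_univ_finset_eq_add_sum_erase
    fun S : Finset (Fin n) => ∑ σ : Equiv.Perm (Fin n), (Equiv.Perm.sign σ : ℤ) •
      ((-1) ^ (n + #S) * (γ + ∑ i ∈ S, A i (σ i)) ^ n), sum_comm]
  · refine sum_congr rfl fun σ _ => ?_
    rw [← smul_sum, ← hprod, smul_comm, nsmul_eq_mul, Units.smul_def]
    rfl
  · intro S i j hij hi hj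
    refine sum_sign_smul_eq_zero_of_notMem S hij hi hj _ fun σ τ h => ?_
    rw [sum_congr rfl fun k hk => by rw [h k hk]]
end

section
/- Let K be a commutative ring that is a ℚ-algebra, let n ≥ 1, and let A = (a_{ij}) be an n×n matrix over K. Then n! • det(A) = [ Σ_{σ even} (Σ_{i=1}^n a_{iσ(i)})^n − Σ_{σ odd} (Σ_{i=1}^n a_{iσ(i)})^n ] − [ Σ_{σ even} Σ_{s=1}^n (Σ_{i≠s} a_{iσ(i)})^n − Σ_{σ odd} Σ_{s=1}^n (Σ_{i≠s} a_{iσ(i)})^n ], where σ ranges over even, respectively odd, permutations of {1,…,n}; equivalently det(A) = (1/n!) Σ_{σ ∈ S_n} sgn(σ) [ (Σ_{i=1}^n a_{iσ(i)})^n − Σ_{s=1}^n (Σ_{i≠s} a_{iσ(i)})^n ]. -/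
open Finset in
/-- Inclusion–exclusion truncated after the singletons: a map `f` contributes to the left-hand side
with weight one minus the number of points it misses. -/
theorem sum_pow_card_sub_sum_erase_pow_card {ι R : Type*} [Fintype ι] [DecidableEq ι] [CommRing R]
    (x : ι → R) :
    (∑ i, x i) ^ Fintype.card ι - ∑ s, (∑ i ∈ univ.erase s, x i) ^ Fintype.card ι =
      ∑ f : ι → ι, (1 - (#{s | ∀ k, f k ≠ s} : ℤ)) • ∏ k, x (f k) := by
  have expand (t : Finset ι) : (∑ i ∈ t, x i) ^ Fintype.card ι =
      ∑ f : ι → ι, if ∀ k, f k ∈ t then ∏ k, x (f k) else 0 := by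
    rw [← card_univ, ← prod_const, prod_univ_sum, ← sum_filter]
    congr 1
    ext f
    simp
  simp_rw [expand]
  rw [sum_comm, ← sum_sub_distrib]
  refine sum_congr rfl fun f _ => ?_
  simp [sub_smul, ← sum_filter]

/-- If `f` misses two points, composing `σ` with their transposition cancels terms in pairs. -/
theorem sum_sign_smul_prod_eq_zero_of_missed {ι κ R : Type*} [Fintype ι] [DecidableEq ι]
    [Fintype κ] [CommRing R] (A : Matrix ι ι R) (f : κ → ι) {a b : ι} (hab : a ≠ b)
    (ha : ∀ k, f k ≠ a) (hb : ∀ k, f k ≠ b) :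
    ∑ σ : Equiv.Perm ι, (Equiv.Perm.sign σ : ℤ) • ∏ k, A (f k) (σ (f k)) = 0 := by
  refine Finset.sum_involution (fun σ _ => σ * Equiv.swap a b) ?_ ?_ (by simp) ?_
  · intro σ _
    simp [Equiv.Perm.sign_swap hab, Equiv.swap_apply_of_ne_of_ne (ha _) (hb _)]
  · intro σ _ _ h
    exact hab (Equiv.swap_eq_one_iff.1 (mul_eq_left.1 h))
  · intro σ _
    simp [mul_assoc]

/-- Reordering the factors of each diagonal product does not change the determinant. -/
theorem sum_sign_smul_prod_perm_eq_det {ι R : Type*} [Fintype ι] [DecidableEq ι] [CommRing R]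
    (A : Matrix ι ι R) (τ : Equiv.Perm ι) :
    ∑ σ : Equiv.Perm ι, (Equiv.Perm.sign σ : ℤ) • ∏ k, A (τ k) (σ (τ k)) = A.det := by
  rw [← Matrix.det_transpose, Matrix.det_apply]
  refine Finset.sum_congr rfl fun σ _ => ?_
  rw [Equiv.prod_comp τ fun i => A i (σ i)]
  rfl

open Finset in
theorem weighted_sum_sign_smul_prod {ι R : Type*} [Fintype ι] [DecidableEq ι] [CommRing R]
    (A : Matrix ι ι R) (f : ι → ι) :
    (1 - (#{s | ∀ k, f k ≠ s} : ℤ)) •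
        ∑ σ : Equiv.Perm ι, (Equiv.Perm.sign σ : ℤ) • ∏ k, A (f k) (σ (f k)) =
      if Function.Bijective f then A.det else 0 := by
  split_ifs with hf
  · have hempty : ({s | ∀ k, f k ≠ s} : Finset ι) = ∅ := by
      ext s
      simpa using hf.surjective s
    simpa [hempty] using sum_sign_smul_prod_perm_eq_det A (Equiv.ofBijective f hf)
  · obtain ⟨s, hs⟩ : ∃ s, ∀ k, f k ≠ s := by
      by_contra! h
      exact hf (Finite.surjective_iff_bijective.1 h)
    have hpos : 0 < #{s | ∀ k, f k ≠ s} := card_pos.2 ⟨s, by simpa using hs⟩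
    obtain hone | htwo : #{s | ∀ k, f k ≠ s} = 1 ∨ 1 < #{s | ∀ k, f k ≠ s} := by lia
    · simp [hone]
    · obtain ⟨a, ha, b, hb, hab⟩ := one_lt_card.1 htwo
      rw [sum_sign_smul_prod_eq_zero_of_missed A f hab (by simpa using ha) (by simpa using hb),
        smul_zero]

/-- **Polynomial identity for determinants (Egorychev, 2012), case `γ = 0`.**
`n! • det A = ∑_{σ} sgn σ • [(∑_i a_{iσ(i)})^n − ∑_s (∑_{i≠s} a_{iσ(i)})^n]`. -/
theorem det_polynomial_identity_zero
    {K : Type*} [CommRing K] [Algebra ℚ K]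
    (n : ℕ) (hn : 1 ≤ n)
    (A : Matrix (Fin n) (Fin n) K) :
    n.factorial • A.det =
      ∑ σ : Equiv.Perm (Fin n), (Equiv.Perm.sign σ : ℤ) •
        ((∑ i, A i (σ i)) ^ n -
          ∑ s : Fin n, (∑ i ∈ Finset.univ.erase s, A i (σ i)) ^ n) := by
  have expand (σ : Equiv.Perm (Fin n)) :=
    sum_pow_card_sub_sum_erase_pow_card fun i => A i (σ i)
  simp only [Fintype.card_fin] at expand
  simp_rw [expand, Finset.smul_sum]
  rw [Finset.sum_comm]
  simp_rw [smul_comm (_ : ℤ) (1 - _ : ℤ), ← Finset.smul_sum, weighted_sum_sign_smul_prod]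
  rw [← Finset.sum_filter, Finset.sum_const, ← Fintype.card_subtype,
    ← Fintype.card_congr (Equiv.ofBijective
      (fun τ : Equiv.Perm (Fin n) =>
        (⟨τ, τ.bijective⟩ : {f : Fin n → Fin n // Function.Bijective f}))
      ⟨fun _ _ h => DFunLike.coe_injective (congrArg Subtype.val h),
        fun f => ⟨Equiv.ofBijective f.1 f.2, rfl⟩⟩),
    Fintype.card_perm, Fintype.card_fin]
end

section
/- Let K be a commutative ring that is a ℚ-algebra, let n ≥ 2, and let A = (a_{ij}) be an n×n matrix over K. Then for every t with 1 ≤ t ≤ n−1, the identity Σ_{σ ∈ S_n} sgn(σ) (Σ_{i=1}^n a_{iσ(i)})^t = Σ_{σ ∈ S_n} sgn(σ) Σ_{s=1}^n (Σ_{i≠s} a_{iσ(i)})^t holds, where S_n is the set of permutations of {1,…,n} and sgn(σ) is the sign of σ. -/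
/-- The alternating sum over all permutations of a product of entries vanishes as soon as
the product involves neither of two distinct rows. -/
theorem sum_sign_smul_prod_eq_zero {K ι κ : Type*} [CommRing K] [Fintype ι] [DecidableEq ι]
    [Fintype κ] (A : Matrix ι ι K) (p : κ → ι) {u v : ι} (huv : u ≠ v)
    (hu : ∀ k, p k ≠ u) (hv : ∀ k, p k ≠ v) :
    ∑ σ : Equiv.Perm ι, (Equiv.Perm.sign σ : ℤ) • ∏ k, A (p k) (σ (p k)) = 0 := by
  refine Finset.sum_involution (fun σ _ => σ * Equiv.swap u v) ?_ ?_ (by simp) ?_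
  · intro σ _
    have h : ∀ k, Equiv.swap u v (p k) = p k :=
      fun k => Equiv.swap_apply_of_ne_of_ne (hu k) (hv k)
    simp [Equiv.Perm.sign_swap huv, h]
  · intro σ _ _ h
    exact huv (Equiv.swap_eq_one_iff.mp (mul_eq_left.mp h))
  · intro σ _
    simp [mul_assoc]

/-- Expansion of a power of a sum over all indices but one. -/
theorem sum_erase_pow {K ι : Type*} [CommSemiring K] [Fintype ι] [DecidableEq ι]
    (f : ι → K) (s : ι) (t : ℕ) :
    (∑ i ∈ Finset.univ.erase s, f i) ^ t =
      ∑ p : Fin t → ι, if ∀ k, p k ≠ s then ∏ k, f (p k) else 0 := by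
  have h := Finset.prod_univ_sum (fun _ : Fin t => Finset.univ.erase s) (fun _ i => f i)
  rw [Finset.prod_const, Finset.card_univ, Fintype.card_fin] at h
  rw [h, ← Finset.sum_filter]
  refine Finset.sum_congr ?_ fun _ _ => rfl
  ext p
  simp [Fintype.mem_piFinset]

/-- **Corollary 1, first part (Egorychev, 2012).**  For `1 ≤ t ≤ n − 1`,
`∑_{σ} sgn σ (∑_i a_{iσ(i)})^t = ∑_{σ} sgn σ ∑_s (∑_{i≠s} a_{iσ(i)})^t`. -/
theorem det_power_identities
    {K : Type*} [CommRing K] [Algebra ℚ K]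
    (n : ℕ) (hn : 2 ≤ n)
    (A : Matrix (Fin n) (Fin n) K)
    (t : ℕ) (ht1 : 1 ≤ t) (ht2 : t ≤ n - 1) :
    (∑ σ : Equiv.Perm (Fin n), (Equiv.Perm.sign σ : ℤ) • (∑ i, A i (σ i)) ^ t) =
      ∑ σ : Equiv.Perm (Fin n), (Equiv.Perm.sign σ : ℤ) •
        ∑ s : Fin n, (∑ i ∈ Finset.univ.erase s, A i (σ i)) ^ t := by
  simp only [sum_erase_pow, Fintype.sum_pow, Finset.smul_sum]
  rw [Finset.sum_comm]
  conv_rhs =>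
    enter [2, σ]
    rw [Finset.sum_comm]
  conv_rhs => rw [Finset.sum_comm]
  refine Finset.sum_congr rfl fun p _ => ?_
  rw [Finset.sum_comm (s := Finset.univ (α := Equiv.Perm (Fin n)))]
  obtain ⟨u, hu⟩ : ∃ u, ∀ k, p k ≠ u := by
    by_contra! h
    have := Fintype.card_le_of_surjective p h
    simp only [Fintype.card_fin] at this
    omega
  rw [Finset.sum_eq_single_of_mem u (Finset.mem_univ u)]
  · simp [hu]
  · intro v _ hvu
    by_cases hv : ∀ k, p k ≠ v
    · simpa only [if_pos hv] using sum_sign_smul_prod_eq_zero A p hvu hv hu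
    · simp [if_neg hv]
end

section
/- Let K be a commutative ring that is a ℚ-algebra, let n ≥ 1, and let A = (a_{ij}) be an n×n matrix over K. Then det(A) = 0 if and only if Σ_{σ ∈ S_n} sgn(σ) (Σ_{i=1}^n a_{iσ(i)})^n = Σ_{σ ∈ S_n} sgn(σ) Σ_{s=1}^n (Σ_{i≠s} a_{iσ(i)})^n, where S_n is the set of permutations of {1,…,n} and sgn(σ) is the sign of σ. -/
open Equiv Finset in
/-- The signed sum over `σ` of the products along a row selection `g` vanishes when `g` misses two
distinct rows. -/
theorem Matrix.sum_sign_smul_prod_eq_zero_of_ne {m ι R : Type*} [Fintype m] [DecidableEq m]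
    [Fintype ι] [CommRing R] (A : Matrix m m R) (g : ι → m) {s t : m} (hst : s ≠ t)
    (hs : ∀ j, g j ≠ s) (ht : ∀ j, g j ≠ t) :
    ∑ σ : Perm m, (Perm.sign σ : ℤ) • ∏ j, A (g j) (σ (g j)) = 0 := by
  refine sum_involution (fun σ _ => σ * Equiv.swap s t) (fun σ _ => ?_) (fun σ _ _ h => ?_)
    (fun _ _ => mem_univ _) (fun σ _ => ?_)
  · simp [Perm.sign_mul, Perm.sign_swap hst, swap_apply_of_ne_of_ne (hs _) (ht _)]
  · exact hst (swap_eq_one_iff.mp (mul_eq_left.mp h))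
  · simp [mul_assoc]

open Equiv Finset in
/-- The signed sum over `σ` of the products along a bijective row selection is the determinant. -/
theorem Matrix.sum_sign_smul_prod_of_bijective {m ι R : Type*} [Fintype m] [DecidableEq m]
    [Fintype ι] [CommRing R] (A : Matrix m m R) {g : ι → m} (hg : Function.Bijective g) :
    ∑ σ : Perm m, (Perm.sign σ : ℤ) • ∏ j, A (g j) (σ (g j)) = A.det := by
  rw [← det_transpose, det_apply]
  refine sum_congr rfl fun σ _ => ?_
  rw [hg.prod_comp fun i => A i (σ i), Units.smul_def]
  rfl

open Equiv Finset in
/-- Weighting a row selection `g` by one minus the number of rows it misses leaves only the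
bijective selections. -/
theorem Matrix.sum_sign_smul_prod_sub_sum_missed {m R : Type*} [Fintype m] [DecidableEq m]
    [CommRing R] (A : Matrix m m R) (g : m → m) [Decidable (Function.Bijective g)] :
    (∑ σ : Perm m, (Perm.sign σ : ℤ) • ∏ j, A (g j) (σ (g j))) -
      ∑ s : m, (if ∀ j, g j ≠ s then
        ∑ σ : Perm m, (Perm.sign σ : ℤ) • ∏ j, A (g j) (σ (g j)) else 0) =
      if Function.Bijective g then A.det else 0 := by
  split_ifs with hg
  · rw [A.sum_sign_smul_prod_of_bijective hg, sub_eq_self]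
    refine sum_eq_zero fun s _ => ?_
    obtain ⟨j, hj⟩ := hg.surjective s
    exact if_neg fun h => h j hj
  · rw [← Finite.surjective_iff_bijective, Function.Surjective] at hg
    push Not at hg
    obtain ⟨s, hs⟩ := hg
    rw [sum_eq_single s, if_pos hs, sub_self]
    · intro t _ hts
      split_ifs with ht
      · exact A.sum_sign_smul_prod_eq_zero_of_ne g hts ht hs
      · rfl
    · simp

open Equiv Finset in
/-- The determinant, up to the factor `n!`, through powers of the entry sums of the diagonals and of
the subdiagonals omitting one row. -/
theorem Matrix.sum_sign_smul_diag_pow_sub {m R : Type*} [Fintype m] [DecidableEq m]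
    [CommRing R] (A : Matrix m m R) :
    (∑ σ : Perm m, (Perm.sign σ : ℤ) • (∑ i, A i (σ i)) ^ Fintype.card m) -
      ∑ σ : Perm m, (Perm.sign σ : ℤ) •
        ∑ s : m, (∑ i ∈ univ.erase s, A i (σ i)) ^ Fintype.card m =
      ((Fintype.card m).factorial : R) * A.det := by
  classical
  have expand (S : Finset m) (σ : Perm m) : (∑ i ∈ S, A i (σ i)) ^ Fintype.card m =
      ∑ g : m → m, if ∀ j, g j ∈ S then ∏ j, A (g j) (σ (g j)) else 0 := by
    rw [← card_univ, ← prod_const, prod_univ_sum, ← sum_filter]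
    refine sum_congr (by ext g; simp [Fintype.mem_piFinset]) fun _ _ => rfl
  have hdiag : ∑ σ : Perm m, (Perm.sign σ : ℤ) • (∑ i, A i (σ i)) ^ Fintype.card m =
      ∑ g : m → m, ∑ σ : Perm m, (Perm.sign σ : ℤ) • ∏ j, A (g j) (σ (g j)) := by
    simp only [expand, mem_univ, implies_true, if_true, smul_sum]
    exact sum_comm
  have hsub : ∑ σ : Perm m, (Perm.sign σ : ℤ) •
        ∑ s : m, (∑ i ∈ univ.erase s, A i (σ i)) ^ Fintype.card m =
      ∑ g : m → m, ∑ s : m, if ∀ j, g j ≠ s then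
        ∑ σ : Perm m, (Perm.sign σ : ℤ) • ∏ j, A (g j) (σ (g j)) else 0 := by
    simp only [expand, mem_erase, mem_univ, and_true, smul_sum]
    rw [sum_comm, sum_comm (s := (univ : Finset (m → m)))]
    refine sum_congr rfl fun s _ => ?_
    rw [sum_comm]
    refine sum_congr rfl fun g _ => ?_
    split_ifs <;> simp
  have hcard : #{g : m → m | Function.Bijective g} = (Fintype.card m).factorial := by
    rw [← Fintype.card_perm, ← Fintype.card_subtype]
    exact Fintype.card_congr
      { toFun := fun g => Equiv.ofBijective g.1 g.2
        invFun := fun σ => ⟨σ, σ.bijective⟩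
        left_inv := fun _ => rfl
        right_inv := fun _ => Equiv.ext fun _ => rfl }
  rw [hdiag, hsub, ← sum_sub_distrib]
  simp only [A.sum_sign_smul_prod_sub_sum_missed]
  rw [← sum_filter, sum_const, hcard, nsmul_eq_mul]


/-- **Corollary 1, second part (Egorychev, 2012).**  `det A = 0` iff
`∑_{σ} sgn σ (∑_i a_{iσ(i)})^n = ∑_{σ} sgn σ ∑_s (∑_{i≠s} a_{iσ(i)})^n`. -/
theorem det_eq_zero_iff_power_identity
    {K : Type*} [CommRing K] [Algebra ℚ K]
    (n : ℕ) (hn : 1 ≤ n)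
    (A : Matrix (Fin n) (Fin n) K) :
    A.det = 0 ↔
      (∑ σ : Equiv.Perm (Fin n), (Equiv.Perm.sign σ : ℤ) • (∑ i, A i (σ i)) ^ n) =
        ∑ σ : Equiv.Perm (Fin n), (Equiv.Perm.sign σ : ℤ) •
          ∑ s : Fin n, (∑ i ∈ Finset.univ.erase s, A i (σ i)) ^ n := by
  have key := A.sum_sign_smul_diag_pow_sub
  rw [Fintype.card_fin] at key
  have hunit : IsUnit (n.factorial : K) := by
    have h := (IsUnit.mk0 (n.factorial : ℚ) (mod_cast n.factorial_ne_zero)).map (algebraMap ℚ K)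
    rwa [map_natCast] at h
  rw [← sub_eq_zero (a := ∑ σ : Equiv.Perm (Fin n), _), key, hunit.mul_right_eq_zero]
end

section
/- Let R be a (possibly noncommutative) associative ring that is a ℚ-algebra, let n ≥ 1, and let x_1,…,x_n, δ ∈ R. Then Σ_{τ ∈ S_n} x_{τ(1)} x_{τ(2)} ⋯ x_{τ(n)} = Σ_{S ⊆ {1,…,n}} (−1)^{n−|S|} (δ + Σ_{i∈S} x_i)^n, where the products x_{τ(1)} ⋯ x_{τ(n)} are taken in the indicated order, the outer sum on the left ranges over all permutations τ of {1,…,n}, and the sum on the right ranges over all subsets S of {1,…,n} (with Σ_{i∈∅} x_i = 0). Equivalently, Sym(x_1 ⋯ x_n) := (1/n!) Σ_{τ ∈ S_n} x_{τ(1)} ⋯ x_{τ(n)} = (1/n!) Σ_{S ⊆ {1,…,n}} (−1)^{n−|S|} (δ + Σ_{i∈S} x_i)^n. -/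
open Finset in
/-- The alternating sum over the finsets `S` for which `p` holds vanishes if `p` does not depend on
whether `a ∈ S`. -/
theorem sum_filter_neg_one_pow_card_compl_eq_zero {R α : Type*} [Ring R] [Fintype α]
    [DecidableEq α] (p : Finset α → Prop) [DecidablePred p] (a : α)
    (hp : ∀ S, a ∉ S → (p (insert a S) ↔ p S)) :
    ∑ S with p S, (-1 : R) ^ (Fintype.card α - #S) = 0 := by
  have huniv : (univ : Finset (Finset α)) = (insert a (univ.erase a)).powerset := by
    rw [insert_erase (mem_univ a), powerset_univ]
  rw [sum_filter, huniv, sum_powerset_insert (notMem_erase a univ), ← sum_add_distrib]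
  refine sum_eq_zero fun S hS => ?_
  have ha : a ∉ S := fun h => notMem_erase a univ (mem_powerset.1 hS h)
  have hcard : #S + 1 ≤ Fintype.card α := by
    rw [← card_insert_of_notMem ha]
    exact card_le_univ _
  have hsub : Fintype.card α - #S = Fintype.card α - (#S + 1) + 1 := by omega
  simp only [hp S ha, card_insert_of_notMem ha]
  split_ifs
  · rw [hsub, pow_succ]
    simp
  · simp

/-- A map `α → Option α`, `α` finite, hitting every `some i` comes from a permutation. -/
theorem exists_perm_eq_some_of_forall_exists {α : Type*} [Finite α] (f : α → Option α)
    (hf : ∀ i, ∃ k, f k = some i) : ∃ τ : Equiv.Perm α, (fun k => some (τ k)) = f := by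
  choose g hg using hf
  have hinj : Function.Injective g := fun i j hij => by
    simpa [hg] using congrArg f hij
  let σ := Equiv.ofBijective g (Finite.injective_iff_bijective.1 hinj)
  refine ⟨σ.symm, funext fun k => ?_⟩
  rw [← hg, show g (σ.symm k) = k from σ.apply_symm_apply k]

open Finset in
/-- The power of a translated subset sum, expanded into ordered products. -/
theorem add_sum_pow_eq_sum_piFinset_insertNone {R : Type*} [Ring R] (n : ℕ) {ι : Type*}
    (x : ι → R) (δ : R) (S : Finset ι) :
    (δ + ∑ i ∈ S, x i) ^ n =
      ∑ f ∈ Fintype.piFinset fun _ : Fin n => insertNone S,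
        (List.ofFn fun k => (f k).elim δ x).prod := by
  classical
  have h := (MultilinearMap.mkPiAlgebraFin ℤ n R).map_sum_finset
    (fun _ o => Option.elim o δ x) (fun _ => insertNone S)
  simpa [MultilinearMap.mkPiAlgebraFin_apply, sum_insertNone] using h

open Finset in
/-- **Polarization identity for the symmetrized product in a noncommutative ring.**
`∑_{τ ∈ S_n} x_{τ(1)} ⋯ x_{τ(n)} = ∑_{S ⊆ {1,…,n}} (−1)^{n−|S|} (δ + ∑_{i∈S} x_i)^n`. -/
theorem sym_product_polynomial_identity
    {R : Type*} [Ring R] [Algebra ℚ R]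
    (n : ℕ) (hn : 1 ≤ n) (x : Fin n → R) (δ : R) :
    (∑ τ : Equiv.Perm (Fin n), (List.ofFn fun k => x (τ k)).prod) =
      ∑ S : Finset (Fin n),
        (-1 : R) ^ (n - S.card) * (δ + ∑ i ∈ S, x i) ^ n := by
  have hexpand : ∀ S : Finset (Fin n), (-1 : R) ^ (n - #S) * (δ + ∑ i ∈ S, x i) ^ n =
      ∑ f : Fin n → Option (Fin n), (if ∀ k, f k ∈ insertNone S then (-1 : R) ^ (n - #S) else 0) *
        (List.ofFn fun k => (f k).elim δ x).prod := fun S => by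
    rw [add_sum_pow_eq_sum_piFinset_insertNone, mul_sum]
    simp only [ite_mul, zero_mul, ← sum_filter]
    refine sum_congr ?_ fun _ _ => rfl
    ext f
    simp only [Fintype.mem_piFinset, mem_filter, mem_univ, true_and]
  simp_rw [hexpand]
  rw [sum_comm]
  simp_rw [← sum_mul]
  refine sum_of_injOn (fun τ k => some (τ k)) ?_ (by simp [Set.MapsTo]) ?_ ?_
  · intro σ _ τ _ h
    exact Equiv.ext fun k => Option.some_injective _ (congrFun h k)
  · intro f _ hf
    obtain ⟨i, hi⟩ : ∃ i, ∀ k, f k ≠ some i := by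
      by_contra! h
      obtain ⟨τ, hτ⟩ := exists_perm_eq_some_of_forall_exists f h
      exact hf ⟨τ, by simp, hτ⟩
    have hzero := sum_filter_neg_one_pow_card_compl_eq_zero (R := R)
      (fun S => ∀ k, f k ∈ insertNone S) i fun S _ => forall_congr' fun k => by
        have hk := hi k
        cases hfk : f k <;> simp_all
    rw [Fintype.card_fin] at hzero
    rw [← sum_filter, hzero, zero_mul]
  · intro τ _
    have huniv : ∀ S : Finset (Fin n), (∀ k, some (τ k) ∈ insertNone S) ↔ S = univ := fun S => by
      simp only [some_mem_insertNone, eq_univ_iff_forall]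
      exact τ.forall_congr_right (q := (· ∈ S))
    simp only [huniv]
    simp
end

section
/- Let R be a (possibly noncommutative) associative ring that is a ℚ-algebra, let n ≥ 1, and let A = (a_{ij}) be an n×n matrix over R. Then the symmetrized permanent satisfies eper(A) = (1/n!) Σ_{∅ ≠ Rw ⊆ {1,…,n}} Σ_{∅ ≠ Cl ⊆ {1,…,n}} (−1)^{|Rw|+|Cl|} (Σ_{i∈Rw} Σ_{j∈Cl} a_{ij})^n, where Rw ranges over all nonempty subsets of row indices and Cl over all nonempty subsets of column indices. -/
/-- The symmetrized permanent over a noncommutative ring `R` which is a `ℚ`-algebra: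
`eper A := ∑_{σ ∈ S_n} Sym(a_{1σ(1)} ⋯ a_{nσ(n)})`, where
`Sym(x_1 ⋯ x_n) := (1/n!) ∑_{τ ∈ S_n} x_{τ(1)} ⋯ x_{τ(n)}` (ordered products). -/
def eper {R : Type*} [Ring R] [Algebra ℚ R] {n : ℕ}
    (A : Matrix (Fin n) (Fin n) R) : R :=
  ∑ σ : Equiv.Perm (Fin n),
    (n.factorial : ℚ)⁻¹ •
      ∑ τ : Equiv.Perm (Fin n), (List.ofFn fun k => A (τ k) (σ (τ k))).prod

/-- The alternating sum over the supersets of the range of `f` vanishes unless `f` is bijective. -/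
theorem sum_neg_one_pow_card_mul_ite_forall_mem {R : Type*} [Ring R] {n : ℕ}
    (f : Fin n → Fin n) :
    ∑ S : Finset (Fin n), (if ∀ k, f k ∈ S then (-1 : R) ^ S.card else 0) =
      if Function.Bijective f then (-1 : R) ^ n else 0 := by
  split_ifs with hf
  · rw [Finset.sum_eq_single Finset.univ]
    · simp
    · intro S _ hS
      refine if_neg fun h => hS (Finset.eq_univ_iff_forall.2 fun x => ?_)
      obtain ⟨k, rfl⟩ := hf.2 x
      exact h k
    · simp
  · obtain ⟨a, ha⟩ : ∃ a, ∀ k, f k ≠ a := by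
      by_contra! h
      exact hf (Finite.surjective_iff_bijective.1 h)
    have mem_insert_iff : ∀ S : Finset (Fin n), (∀ k, f k ∈ insert a S) ↔ ∀ k, f k ∈ S :=
      fun S => forall_congr' fun k => by simp [ha k]
    rw [← Finset.powerset_univ, ← Finset.insert_erase (Finset.mem_univ a),
      Finset.sum_powerset_insert (Finset.notMem_erase a _), ← Finset.sum_add_distrib]
    refine Finset.sum_eq_zero fun S hS => ?_
    have haS : a ∉ S := fun h => by simpa using Finset.mem_powerset.1 hS h
    simp only [mem_insert_iff, Finset.card_insert_of_notMem haS]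
    split_ifs <;> simp [pow_succ]

/-- A sum over the bijective self-maps of `Fin n` is a sum over permutations. -/
theorem sum_ite_bijective {M : Type*} [AddCommMonoid M] {n : ℕ} (F : (Fin n → Fin n) → M) :
    ∑ f : Fin n → Fin n, (if Function.Bijective f then F f else 0) =
      ∑ σ : Equiv.Perm (Fin n), F σ := by
  rw [← Finset.sum_filter]
  symm
  refine Finset.sum_bij (fun σ _ => ⇑σ)
    (fun σ _ => Finset.mem_filter.2 ⟨Finset.mem_univ _, σ.bijective⟩)
    (fun σ _ τ _ h => DFunLike.coe_injective h) (fun f hf => ?_) (fun _ _ => rfl)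
  exact ⟨Equiv.ofBijective f (Finset.mem_filter.1 hf).2, Finset.mem_univ _, rfl⟩

/-- Inclusion-exclusion: an alternating sum over subsets of sums over the maps into them
reduces to a sum over permutations. -/
theorem sum_neg_one_pow_card_mul_sum_piFinset {R : Type*} [Ring R] {n : ℕ}
    (F : (Fin n → Fin n) → R) :
    ∑ S : Finset (Fin n),
        (-1 : R) ^ S.card * ∑ f ∈ Fintype.piFinset (fun _ : Fin n => S), F f =
      (-1 : R) ^ n * ∑ σ : Equiv.Perm (Fin n), F σ := by
  have expand : ∀ S : Finset (Fin n),
      (-1 : R) ^ S.card * ∑ f ∈ Fintype.piFinset (fun _ : Fin n => S), F f =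
        ∑ f : Fin n → Fin n, (if ∀ k, f k ∈ S then (-1 : R) ^ S.card else 0) * F f := by
    intro S
    rw [Finset.mul_sum, ← Finset.sum_subset (Finset.subset_univ (Fintype.piFinset fun _ => S))]
    · exact Finset.sum_congr rfl fun f hf => by rw [if_pos (Fintype.mem_piFinset.1 hf)]
    · intro f _ hf
      rw [if_neg (fun h => hf (Fintype.mem_piFinset.2 h)), zero_mul]
  simp_rw [expand]
  rw [Finset.sum_comm, Finset.mul_sum, ← sum_ite_bijective fun f => (-1 : R) ^ n * F f]
  refine Finset.sum_congr rfl fun f _ => ?_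
  rw [← Finset.sum_mul, sum_neg_one_pow_card_mul_ite_forall_mem, ite_mul, zero_mul]

/-- Expansion of an ordered product of sums in a noncommutative ring. -/
theorem prod_ofFn_sum {R ι : Type*} [Ring R] [DecidableEq ι] {n : ℕ} (s : Finset ι)
    (g : Fin n → ι → R) :
    (List.ofFn fun k => ∑ i ∈ s, g k i).prod =
      ∑ f ∈ Fintype.piFinset (fun _ : Fin n => s), (List.ofFn fun k => g k (f k)).prod := by
  simpa only [MultilinearMap.mkPiAlgebraFin_apply] using
    (MultilinearMap.mkPiAlgebraFin ℤ n R).map_sum_finset g (fun _ => s)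

/-- Expansion of the `n`-th power of the sum of the entries of a submatrix. -/
theorem sum_sum_pow_eq_sum_piFinset {R : Type*} [Ring R] {n : ℕ}
    (A : Matrix (Fin n) (Fin n) R) (Rw Cl : Finset (Fin n)) :
    (∑ i ∈ Rw, ∑ j ∈ Cl, A i j) ^ n =
      ∑ f ∈ Fintype.piFinset (fun _ : Fin n => Rw),
        ∑ g ∈ Fintype.piFinset (fun _ : Fin n => Cl), (List.ofFn fun k => A (f k) (g k)).prod := by
  rw [← List.prod_replicate, ← List.ofFn_const, prod_ofFn_sum]
  exact Finset.sum_congr rfl fun f _ => prod_ofFn_sum Cl fun k => A (f k)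

/-- The alternating sum of powers of submatrix sums is a double sum over permutations. -/
theorem sum_sum_neg_one_pow_mul_pow {R : Type*} [Ring R] {n : ℕ}
    (A : Matrix (Fin n) (Fin n) R) :
    ∑ Rw : Finset (Fin n), ∑ Cl : Finset (Fin n),
        (-1 : R) ^ (Rw.card + Cl.card) * (∑ i ∈ Rw, ∑ j ∈ Cl, A i j) ^ n =
      ∑ τ : Equiv.Perm (Fin n), ∑ σ : Equiv.Perm (Fin n),
        (List.ofFn fun k => A (τ k) (σ k)).prod := by
  have inner : ∀ Rw : Finset (Fin n), ∑ Cl : Finset (Fin n),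
      (-1 : R) ^ (Rw.card + Cl.card) * (∑ i ∈ Rw, ∑ j ∈ Cl, A i j) ^ n =
        (-1 : R) ^ Rw.card * ∑ f ∈ Fintype.piFinset (fun _ : Fin n => Rw),
          (-1 : R) ^ n * ∑ σ : Equiv.Perm (Fin n), (List.ofFn fun k => A (f k) (σ k)).prod := by
    intro Rw
    simp_rw [pow_add, mul_assoc, ← Finset.mul_sum, sum_sum_pow_eq_sum_piFinset]
    congr 1
    simp_rw [Finset.mul_sum (Fintype.piFinset fun _ => Rw)]
    rw [Finset.sum_comm]
    exact Finset.sum_congr rfl fun f _ =>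
      sum_neg_one_pow_card_mul_sum_piFinset fun g => (List.ofFn fun k => A (f k) (g k)).prod
  simp_rw [inner]
  rw [sum_neg_one_pow_card_mul_sum_piFinset (fun f => (-1 : R) ^ n *
    ∑ σ : Equiv.Perm (Fin n), (List.ofFn fun k => A (f k) (σ k)).prod), ← Finset.mul_sum,
    ← mul_assoc, ← pow_add, Even.neg_one_pow ⟨n, rfl⟩, one_mul]

/-- **Theorem 4 (Egorychev): polynomial identity for the symmetrized permanent,
case `δ = 0`.**  `eper A = (1/n!) ∑_{∅≠Rw} ∑_{∅≠Cl} (−1)^{|Rw|+|Cl|} su(B)^n`. -/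
theorem eper_polynomial_identity_zero
    {R : Type*} [Ring R] [Algebra ℚ R]
    (n : ℕ) (hn : 1 ≤ n)
    (A : Matrix (Fin n) (Fin n) R) :
    eper A =
      (n.factorial : ℚ)⁻¹ •
        ∑ Rw ∈ Finset.univ.filter (fun S : Finset (Fin n) => S ≠ ∅),
          ∑ Cl ∈ Finset.univ.filter (fun S : Finset (Fin n) => S ≠ ∅),
            (-1 : R) ^ (Rw.card + Cl.card) *
              (∑ i ∈ Rw, ∑ j ∈ Cl, A i j) ^ n := by
  have hn0 : n ≠ 0 := Nat.one_le_iff_ne_zero.1 hn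
  rw [Finset.sum_filter_of_ne, Finset.sum_congr rfl fun Rw _ => Finset.sum_filter_of_ne ?_,
    sum_sum_neg_one_pow_mul_pow, eper, ← Finset.smul_sum, Finset.sum_comm]
  · congr 1
    exact Finset.sum_congr rfl fun τ _ => Fintype.sum_equiv (Equiv.mulRight τ) _ _ fun σ => rfl
  · rintro Cl - h rfl
    simp [hn0] at h
  · rintro Rw - h rfl
    simp [hn0] at h
end

section
/- Let R be a (possibly noncommutative) associative ring that is a ℚ-algebra, let n ≥ 2, and let A = (a_{ij}) be an n×n matrix over R. Then for every m with 1 ≤ m ≤ n−1, the identity Σ_{∅ ≠ Rw ⊆ {1,…,n}} Σ_{∅ ≠ Cl ⊆ {1,…,n}} (−1)^{|Rw|+|Cl|} (Σ_{i∈Rw} Σ_{j∈Cl} a_{ij})^m = 0 holds, where Rw ranges over all nonempty subsets of row indices and Cl over all nonempty subsets of column indices. -/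
/-- The alternating sum over all supersets of a proper subset vanishes. -/
theorem sum_superset_neg_one_pow_card {ι R : Type*} [Fintype ι] [DecidableEq ι] [Ring R]
    (T : Finset ι) (hT : T.card < Fintype.card ι) :
    ∑ S ∈ Finset.univ.filter (fun S : Finset ι => T ⊆ S), (-1 : R) ^ S.card = 0 := by
  obtain ⟨x, hx⟩ : ∃ x, x ∉ T := by
    by_contra! h
    rw [Finset.eq_univ_of_forall h, Finset.card_univ] at hT
    exact lt_irrefl _ hT
  refine Finset.sum_involution (fun S _ => if x ∈ S then S.erase x else insert x S) ?_ ?_ ?_ ?_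
  · intro S _
    by_cases h : x ∈ S
    · rw [if_pos h, ← Finset.card_erase_add_one h, pow_succ]
      simp
    · rw [if_neg h, Finset.card_insert_of_notMem h, pow_succ]
      simp
  · intro S _ _ heq
    by_cases h : x ∈ S
    · rw [if_pos h] at heq
      exact Finset.erase_eq_self.1 heq h
    · rw [if_neg h] at heq
      exact h (Finset.insert_eq_self.1 heq)
  · intro S hS
    simp only [Finset.mem_filter, Finset.mem_univ, true_and] at hS ⊢
    by_cases h : x ∈ S
    · rw [if_pos h]
      exact Finset.subset_erase.2 ⟨hS, hx⟩
    · rw [if_neg h]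
      exact hS.trans (Finset.subset_insert x S)
  · intro S _
    by_cases h : x ∈ S <;> simp [h]

/-- The alternating sum of `m`-th powers of subset sums, over all supersets of a set `T`,
vanishes when `m + |T|` is less than the number of indices. -/
theorem sum_superset_neg_one_pow_card_mul_sum_pow {ι R : Type*} [Fintype ι] [DecidableEq ι]
    [Ring R] (b : ι → R) (m : ℕ) (T : Finset ι) (hT : m + T.card < Fintype.card ι) :
    ∑ S ∈ Finset.univ.filter (fun S : Finset ι => T ⊆ S),
      (-1 : R) ^ S.card * (∑ i ∈ S, b i) ^ m = 0 := by
  induction m generalizing T with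
  | zero => simpa using sum_superset_neg_one_pow_card (R := R) T (by omega)
  | succ m ih =>
    calc
      _ = ∑ S ∈ Finset.univ.filter (fun S : Finset ι => T ⊆ S), ∑ i ∈ S,
            (-1 : R) ^ S.card * (∑ i ∈ S, b i) ^ m * b i := by
        simp only [pow_succ _ m, ← mul_assoc, Finset.mul_sum]
      _ = ∑ i, ∑ S ∈ Finset.univ.filter (fun S : Finset ι => insert i T ⊆ S),
            (-1 : R) ^ S.card * (∑ i ∈ S, b i) ^ m * b i := by
        refine Finset.sum_comm' fun S i => ?_
        simp [Finset.insert_subset_iff, and_comm]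
      _ = 0 := by
        refine Finset.sum_eq_zero fun i _ => ?_
        have := Finset.card_insert_le i T
        rw [← Finset.sum_mul, ih (insert i T) (by omega), zero_mul]

/-- **Corollary 2, first part (Egorychev).**  For `1 ≤ m ≤ n − 1`,
`∑_{∅≠Rw} ∑_{∅≠Cl} (−1)^{|Rw|+|Cl|} (∑_{i∈Rw} ∑_{j∈Cl} a_{ij})^m = 0`. -/
theorem eper_power_identities
    {R : Type*} [Ring R] [Algebra ℚ R]
    (n : ℕ) (hn : 2 ≤ n)
    (A : Matrix (Fin n) (Fin n) R)
    (m : ℕ) (hm1 : 1 ≤ m) (hm2 : m ≤ n - 1) :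
    (∑ Rw ∈ Finset.univ.filter (fun S : Finset (Fin n) => S ≠ ∅),
      ∑ Cl ∈ Finset.univ.filter (fun S : Finset (Fin n) => S ≠ ∅),
        (-1 : R) ^ (Rw.card + Cl.card) *
          (∑ i ∈ Rw, ∑ j ∈ Cl, A i j) ^ m) = 0 := by
  have hm : m ≠ 0 := by omega
  rw [Finset.sum_comm]
  refine Finset.sum_eq_zero fun Cl _ => ?_
  have key := sum_superset_neg_one_pow_card_mul_sum_pow (fun i => ∑ j ∈ Cl, A i j) m ∅
    (by simp; omega)
  simp only [Finset.empty_subset, Finset.filter_true] at key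
  rw [Finset.sum_filter_of_ne]
  · simp only [add_comm _ Cl.card, pow_add, mul_assoc]
    rw [← Finset.mul_sum, key, mul_zero]
  · rintro S _ hS rfl
    simp [hm] at hS
end

section
/- Let K be a commutative ring that is a ℚ-algebra, let n ≥ 1, and let Ã = (a^{(k)}_{ij}) be an n×n×n space matrix over K, with sections A_k = (a^{(k)}_{ij}) for k = 1,…,n and with α^{(k)}_j = (a^{(k)}_{1j},…,a^{(k)}_{nj})^T the j-th column of A_k. Define Det_p(Ã) := Σ_{σ ∈ S_n} sgn(σ) · per(α^{(1)}_{σ(1)}, α^{(2)}_{σ(2)}, …, α^{(n)}_{σ(n)}), i.e. the signed sum over permutations σ of the permanents of the n×n matrices whose j-th column is α^{(j)}_{σ(j)}. Then Det_p(Ã) = Σ_{σ ∈ S_n} sgn(σ) ∏_{t=1}^n (Σ_{i=1}^n a^{(i)}_{t σ(i)}) − Σ_{σ ∈ S_n} sgn(σ) Σ_{s=1}^n ∏_{t=1}^n (Σ_{i≠s} a^{(i)}_{t σ(i)}), where in the second term the inner sum Σ_{i≠s} a^{(i)}_{t σ(i)} equals −a^{(s)}_{t σ(s)} + Σ_{i=1}^n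 a^{(i)}_{t σ(i)}. -/
/-- The permanent of a square matrix: `per A = ∑_{σ ∈ S_n} ∏ i, a_{i σ(i)}`. -/
def perm' {K : Type*} [CommRing K] {n : ℕ} (A : Matrix (Fin n) (Fin n) K) : K :=
  ∑ σ : Equiv.Perm (Fin n), ∏ i, A i (σ i)

/-- The permanental determinant of a space (three-dimensional) `n × n × n` matrix
`a`, where `a k i j = a^{(k)}_{ij}` is the `(i,j)` entry of the `k`-th section:
`Det_p(Ã) := ∑_{σ ∈ S_n} sgn σ · per(α^{(1)}_{σ(1)}, …, α^{(n)}_{σ(n)})`, the matrix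
in the `σ`-term having `j`-th column `α^{(j)}_{σ(j)} = (a^{(j)}_{1σ(j)}, …, a^{(j)}_{nσ(j)})ᵀ`. -/
def Detp {K : Type*} [CommRing K] {n : ℕ} (a : Fin n → Fin n → Fin n → K) : K :=
  ∑ σ : Equiv.Perm (Fin n),
    (Equiv.Perm.sign σ : ℤ) • perm' (Matrix.of fun i j => a j i (σ j))

/-- The signed sum over `σ` of the monomials `∏ t, a (f t) t (σ (f t))` attached to a map `f`. -/
def signedMonomialSum {K : Type*} [CommRing K] {n : ℕ} (a : Fin n → Fin n → Fin n → K)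
    (f : Fin n → Fin n) : K :=
  ∑ σ : Equiv.Perm (Fin n), (Equiv.Perm.sign σ : ℤ) • ∏ t, a (f t) t (σ (f t))

/-- The signed sum vanishes for a map that misses two values. -/
theorem signedMonomialSum_eq_zero {K : Type*} [CommRing K] {n : ℕ}
    (a : Fin n → Fin n → Fin n → K) (f : Fin n → Fin n) {s s' : Fin n} (hne : s ≠ s')
    (hs : ∀ t, f t ≠ s) (hs' : ∀ t, f t ≠ s') : signedMonomialSum a f = 0 := by
  refine Finset.sum_involution (fun σ _ => σ * Equiv.swap s s') ?_ ?_ ?_ ?_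
  · intro σ _
    simp [Equiv.Perm.sign_swap hne, Equiv.swap_apply_of_ne_of_ne (hs _) (hs' _)]
  · intro σ _ _ h
    exact hne (Equiv.swap_eq_one_iff.mp (mul_eq_left.mp h))
  · simp
  · intro σ _
    simp [mul_assoc]

theorem Detp_eq_sum_signedMonomialSum {K : Type*} [CommRing K] {n : ℕ}
    (a : Fin n → Fin n → Fin n → K) :
    Detp a = ∑ τ : Equiv.Perm (Fin n), signedMonomialSum a τ := by
  simp only [Detp, perm', signedMonomialSum, Matrix.of_apply, Finset.smul_sum]
  exact Finset.sum_comm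

theorem sum_sign_smul_prod_sum {K : Type*} [CommRing K] {n : ℕ}
    (a : Fin n → Fin n → Fin n → K) (S : Finset (Fin n)) :
    ∑ σ : Equiv.Perm (Fin n), (Equiv.Perm.sign σ : ℤ) • ∏ t, ∑ i ∈ S, a i t (σ i) =
      ∑ f : Fin n → Fin n, if ∀ t, f t ∈ S then signedMonomialSum a f else 0 := by
  have hS : Fintype.piFinset (fun _ : Fin n => S) =
      Finset.univ.filter (fun f : Fin n → Fin n => ∀ t, f t ∈ S) := by
    ext f
    simp
  simp only [Finset.prod_univ_sum, Finset.smul_sum]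
  rw [Finset.sum_comm, hS, Finset.sum_filter]
  rfl

/-- **Theorem 5 (Egorychev): polynomial identity for the permanental determinant of a
space matrix.**
`Det_p(Ã) = ∑_{σ} sgn σ ∏_t (∑_i a^{(i)}_{tσ(i)}) − ∑_{σ} sgn σ ∑_s ∏_t (∑_{i≠s} a^{(i)}_{tσ(i)})`. -/
theorem detp_polynomial_identity
    {K : Type*} [CommRing K] [Algebra ℚ K]
    (n : ℕ) (hn : 1 ≤ n)
    (a : Fin n → Fin n → Fin n → K) :
    Detp a =
      (∑ σ : Equiv.Perm (Fin n), (Equiv.Perm.sign σ : ℤ) •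
          ∏ t, ∑ i, a i t (σ i)) -
        ∑ σ : Equiv.Perm (Fin n), (Equiv.Perm.sign σ : ℤ) •
          ∑ s : Fin n, ∏ t, ∑ i ∈ Finset.univ.erase s, a i t (σ i) := by
  simp only [Finset.smul_sum]
  rw [Finset.sum_comm (s := Finset.univ (α := Equiv.Perm (Fin n))) (t := Finset.univ (α := Fin n))]
  simp only [sum_sign_smul_prod_sum]
  rw [Finset.sum_comm, ← Finset.sum_sub_distrib, Detp_eq_sum_signedMonomialSum]
  refine Finset.sum_of_injOn (fun τ => ⇑τ) DFunLike.coe_injective.injOn (by simp) ?_ ?_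
  · intro f _ hf
    have hsurj : ¬ Function.Surjective f := fun h =>
      hf ⟨Equiv.ofBijective f (Finite.surjective_iff_bijective.mp h), by simp, rfl⟩
    simp only [Function.Surjective, not_forall, not_exists] at hsurj
    obtain ⟨s, hs⟩ := hsurj
    by_cases h : ∃ s', s ≠ s' ∧ ∀ t, f t ≠ s'
    · obtain ⟨s', hne, hs'⟩ := h
      simp [signedMonomialSum_eq_zero a f hne hs hs']
    · rw [Finset.sum_eq_single s]
      · simp [hs]
      · intro s' _ hne
        exact if_neg fun h' => h ⟨s', hne.symm, fun t => (Finset.mem_erase.mp (h' t)).1⟩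
      · simp
  · intro τ _
    have hτ (s : Fin n) : ¬ ∀ t, τ t ∈ Finset.univ.erase s := fun h =>
      (Finset.mem_erase.mp (h (τ.symm s))).1 (τ.apply_symm_apply s)
    simp only [hτ, Finset.mem_univ, implies_true, if_true, if_false, Finset.sum_const_zero,
      sub_zero]
end
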